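/- Let $w\in\mathbb{C}$ and let $a,b$ be positive real numbers. Then $\lim_{z\to 1}\frac14\,\Gamma\!\left(-\frac{z}{2}\right)\zeta(-z)\left\{b^{\frac{1+z}{2}}\,{}_1F_1\!\left(\frac{1+z}{2};\frac12;\frac{w^2}{4}\right)-a^{\frac{1+z}{2}}\,{}_1F_1\!\left(\frac{1+z}{2};\frac12;-\frac{w^2}{4}\right)\right\}=\frac{\sqrt{\pi}}{24}\left[b\left(1+\frac{\sqrt{\pi}\,w}{2}e^{\frac{w^2}{4}}\,\mathrm{erf}\!\left(\frac{w}{2}\right)\right)-a\left(1-\frac{\sqrt{\pi}\,w}{2}e^{-\frac{w^2}{4}}\,\mathrm{erfi}\!\left(\frac{w}{2}\right)\right)\right]$. -/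

import Mathlib

open Complex MeasureTheory Filter

noncomputable section

/-- Pochhammer symbol (a)_m = a(a+1)...(a+m-1). -/
def poch (a : ℂ) (m : ℕ) : ℂ := ∏ i ∈ Finset.range m, (a + i)

/-- Confluent hypergeometric function ₁F₁(a;c;z). -/
def hyp1F1 (a c z : ℂ) : ℂ := ∑' m : ℕ, poch a m / (poch c m * (m.factorial : ℂ)) * z ^ m

/-- Humbert function Φ₃(a;c;x,y). -/
def Phi3 (a c x y : ℂ) : ℂ :=
  ∑' p : ℕ × ℕ,
    poch a p.1 / (poch c (p.1 + p.2) * (p.1.factorial : ℂ) * (p.2.factorial : ℂ))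
      * x ^ p.1 * y ^ p.2

/-- Generalized hypergeometric function ₂F₂(a₁,a₂;b₁,b₂;z). -/
def hyp2F2 (a₁ a₂ b₁ b₂ z : ℂ) : ℂ :=
  ∑' m : ℕ, poch a₁ m * poch a₂ m / (poch b₁ m * poch b₂ m * (m.factorial : ℂ)) * z ^ m

/-- Error function, extended to complex arguments along the segment from 0 to w. -/
def cerf (w : ℂ) : ℂ :=
  2 / (Real.sqrt Real.pi : ℂ) * ∫ t in (0:ℝ)..1, w * Complex.exp (-(((t:ℂ) * w) ^ 2))

/-- Imaginary error function, extended to complex arguments. -/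
def cerfi (w : ℂ) : ℂ :=
  2 / (Real.sqrt Real.pi : ℂ) * ∫ t in (0:ℝ)..1, w * Complex.exp (((t:ℂ) * w) ^ 2)

/-- Contour integral along the vertical line Re(s) = c : ∫_{(c)} f(s) ds. -/
def lineInt (c : ℝ) (f : ℂ → ℂ) : ℂ := Complex.I * ∫ t : ℝ, f (c + t * Complex.I)

/-- Generalized modified Bessel function K_{z,w}(x), defined with contour Re(s)=c. -/
def Kzw (z w x : ℂ) (c : ℝ) : ℂ :=
  (2 * (Real.pi : ℂ) * Complex.I)⁻¹ *
    lineInt c (fun s =>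
      Complex.Gamma ((s - z) / 2) * Complex.Gamma ((s + z) / 2) *
        hyp1F1 ((s - z) / 2) (1/2) (-w^2 / 4) * hyp1F1 ((s + z) / 2) (1/2) (-w^2 / 4) *
        (2:ℂ) ^ (s - 2) * x ^ (-s))

/-- Divisor function σ₋₁(n) = ∑_{d ∣ n} 1/d. -/
def sigmaNegOne (n : ℕ) : ℝ := ∑ d ∈ n.divisors, (d : ℝ)⁻¹

/-- Gaussian density. -/
def gauss (σ x : ℝ) : ℝ := Real.exp (-(x^2) / (2 * σ^2)) / (σ * Real.sqrt (2 * Real.pi))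

/-- Lorentzian density. -/
def lorentz (β x : ℝ) : ℝ := β / (Real.pi * (x^2 + β^2))

/-- Voigt profile: convolution of Gaussian and Lorentzian. -/
def voigt (σ β x : ℝ) : ℝ := ∫ t : ℝ, gauss σ t * lorentz β (x - t)

/-- Faddeeva function ξ(y) = e^{-y²}(1 - erf(-iy)). -/
def faddeeva (y : ℂ) : ℂ := Complex.exp (-y^2) * (1 - cerf (-Complex.I * y))


lemma poch_succ (a : ℂ) (m : ℕ) : poch a (m + 1) = poch a m * (a + m) :=
  Finset.prod_range_succ _ _

lemma poch_one (m : ℕ) : poch 1 m = (m.factorial : ℂ) := by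
  induction m with
  | zero => simp [poch]
  | succ m ih => rw [poch_succ, ih, Nat.factorial_succ]; push_cast; ring

lemma half_add_nat_le_norm (m : ℕ) : (1 / 2 + m : ℝ) ≤ ‖(1 / 2 + m : ℂ)‖ := by
  have h := Complex.re_le_norm (1 / 2 + m : ℂ)
  simpa using h

lemma half_add_nat_ne_zero (m : ℕ) : (1 / 2 + m : ℂ) ≠ 0 := by
  rw [← norm_pos_iff]
  exact lt_of_lt_of_le (by positivity) (half_add_nat_le_norm m)

lemma poch_half_ne_zero (m : ℕ) : poch (1 / 2) m ≠ 0 :=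
  Finset.prod_ne_zero_iff.2 fun i _ => half_add_nat_ne_zero i

lemma norm_poch_le {a : ℂ} (ha : ‖a‖ ≤ 2) (m : ℕ) :
    ‖poch a m‖ ≤ 4 ^ m * ‖poch (1 / 2) m‖ := by
  induction m with
  | zero => simp [poch]
  | succ m ih =>
    have hfac : ‖a + m‖ ≤ 4 * ‖(1 / 2 + m : ℂ)‖ := by
      have h₁ := norm_add_le a (m : ℂ)
      have h₂ := half_add_nat_le_norm m
      have h₃ : (0 : ℝ) ≤ m := m.cast_nonneg
      rw [Complex.norm_natCast] at h₁
      linarith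
    rw [poch_succ, poch_succ, norm_mul, norm_mul]
    calc ‖poch a m‖ * ‖a + m‖
        ≤ (4 ^ m * ‖poch (1 / 2) m‖) * (4 * ‖(1 / 2 + m : ℂ)‖) := by gcongr
      _ = _ := by ring

lemma norm_hyp1F1_half_term_le {a : ℂ} (ha : ‖a‖ ≤ 2) (x : ℂ) (m : ℕ) :
    ‖poch a m / (poch (1 / 2) m * (m.factorial : ℂ)) * x ^ m‖
      ≤ (4 * ‖x‖) ^ m / m.factorial := by
  have hp : 0 < ‖poch (1 / 2) m‖ := norm_pos_iff.2 (poch_half_ne_zero m)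
  have hf : (0 : ℝ) < m.factorial := by positivity
  rw [norm_mul, norm_div, norm_mul, norm_pow, Complex.norm_natCast, mul_pow, mul_div_right_comm]
  gcongr ?_ * _
  rw [div_le_div_iff₀ (by positivity) hf]
  calc ‖poch a m‖ * (m.factorial : ℝ)
      ≤ (4 ^ m * ‖poch (1 / 2) m‖) * m.factorial := by gcongr; exact norm_poch_le ha m
    _ = _ := by ring

lemma continuous_poch (m : ℕ) : Continuous fun a : ℂ => poch a m := by
  unfold poch
  fun_prop

/-- The function `a ↦ ₁F₁(a; 1/2; x)` is continuous at `1`. -/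
lemma continuousAt_hyp1F1_half (x : ℂ) : ContinuousAt (fun a => hyp1F1 a (1 / 2) x) 1 := by
  have h : ContinuousOn (fun a => hyp1F1 a (1 / 2) x) (Metric.closedBall 0 2) := by
    refine continuousOn_tsum (u := fun m : ℕ => (4 * ‖x‖) ^ m / m.factorial) (fun m => ?_)
      (Real.summable_pow_div_factorial _) fun m a ha => ?_
    · exact (((continuous_poch m).div_const _).mul_const _).continuousOn
    · exact norm_hyp1F1_half_term_le (by simpa using ha) x m
  exact h.continuousAt (Metric.closedBall_mem_nhds_of_mem (by simp))

lemma integral_one_sub_sq_pow_succ (n : ℕ) :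
    (2 * n + 3 : ℂ) * ∫ t in (0 : ℝ)..1, (1 - (t : ℂ) ^ 2) ^ (n + 1)
      = (2 * n + 2) * ∫ t in (0 : ℝ)..1, (1 - (t : ℂ) ^ 2) ^ n := by
  have hd : ∀ t ∈ Set.uIcc (0 : ℝ) 1, HasDerivAt
      (fun t : ℝ => (t : ℂ) * (1 - (t : ℂ) ^ 2) ^ (n + 1))
      ((2 * n + 3) * (1 - (t : ℂ) ^ 2) ^ (n + 1) - (2 * n + 2) * (1 - (t : ℂ) ^ 2) ^ n) t := by
    intro t _
    have h₁ : HasDerivAt (fun t : ℝ => (t : ℂ)) 1 t := Complex.ofRealCLM.hasDerivAt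
    convert! h₁.mul (((h₁.pow 2).const_sub 1).pow (n + 1)) using 1
    simp
    ring
  have h := intervalIntegral.integral_eq_sub_of_hasDerivAt hd
    (Continuous.intervalIntegrable (by fun_prop) _ _)
  rw [intervalIntegral.integral_sub (Continuous.intervalIntegrable (by fun_prop) _ _)
    (Continuous.intervalIntegrable (by fun_prop) _ _), intervalIntegral.integral_const_mul,
    intervalIntegral.integral_const_mul] at h
  simpa [sub_eq_zero] using h

lemma integral_one_sub_sq_pow (n : ℕ) :
    ∫ t in (0 : ℝ)..1, (1 - (t : ℂ) ^ 2) ^ n = n.factorial / (2 * poch (1 / 2) (n + 1)) := by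
  induction n with
  | zero => simp [poch]
  | succ n ih =>
    have h := integral_one_sub_sq_pow_succ n
    have hp := poch_half_ne_zero (n + 1)
    have hn := half_add_nat_ne_zero (n + 1)
    have h3 : (2 * n + 3 : ℂ) ≠ 0 := by
      intro h0
      apply hn
      push_cast
      linear_combination h0 / 2
    rw [ih] at h
    apply mul_left_cancel₀ h3
    rw [h, poch_succ _ (n + 1), Nat.factorial_succ,
      show (1 / 2 + (n + 1 : ℕ) : ℂ) = (2 * n + 3) / 2 by push_cast; ring]
    field_simp
    push_cast
    ring

/-- Integral representation of `₁F₁(1; 1/2; x)`. -/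
lemma hyp1F1_one_half (x : ℂ) :
    hyp1F1 1 (1 / 2) x
      = 1 + 2 * x * Complex.exp x * ∫ t in (0 : ℝ)..1, Complex.exp (-((t : ℂ) ^ 2 * x)) := by
  have hexp : ∀ t : ℝ, HasSum (fun n : ℕ => ((1 - (t : ℂ) ^ 2) * x) ^ n / (n.factorial : ℂ))
      (Complex.exp ((1 - (t : ℂ) ^ 2) * x)) := fun t => by
    rw [Complex.exp_eq_exp_ℂ]
    exact NormedSpace.expSeries_div_hasSum_exp _
  have hsum : HasSum
      (fun n : ℕ => ∫ t in (0 : ℝ)..1, ((1 - (t : ℂ) ^ 2) * x) ^ n / (n.factorial : ℂ))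
      (∫ t in (0 : ℝ)..1, Complex.exp ((1 - (t : ℂ) ^ 2) * x)) := by
    refine intervalIntegral.hasSum_integral_of_dominated_convergence
      (fun n _ => ‖x‖ ^ n / n.factorial) (fun n => ?_) (fun n => ?_) ?_ ?_ ?_
    · exact Continuous.aestronglyMeasurable (by fun_prop)
    · refine Eventually.of_forall fun t ht => ?_
      rw [Set.uIoc_of_le zero_le_one] at ht
      have hle : ‖1 - (t : ℂ) ^ 2‖ ≤ 1 := by
        have : (1 - (t : ℂ) ^ 2) = ((1 - t ^ 2 : ℝ) : ℂ) := by push_cast; ring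
        rw [this, Complex.norm_real, Real.norm_eq_abs, abs_le]
        constructor <;> nlinarith [ht.1, ht.2]
      rw [norm_div, norm_pow, norm_mul, Complex.norm_natCast]
      gcongr
      exact mul_le_of_le_one_left (norm_nonneg _) hle
    · exact Eventually.of_forall fun _ _ => Real.summable_pow_div_factorial _
    · exact intervalIntegrable_const
    · exact Eventually.of_forall fun t _ => hexp t
  have hterm : ∀ n : ℕ, 2 * x * ∫ t in (0 : ℝ)..1, ((1 - (t : ℂ) ^ 2) * x) ^ n / (n.factorial : ℂ)
      = poch 1 (n + 1) / (poch (1 / 2) (n + 1) * ((n + 1).factorial : ℂ)) * x ^ (n + 1) := by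
    intro n
    have hp := poch_half_ne_zero (n + 1)
    have hf : (n.factorial : ℂ) ≠ 0 := Nat.cast_ne_zero.2 n.factorial_ne_zero
    have hf' : ((n + 1).factorial : ℂ) ≠ 0 := Nat.cast_ne_zero.2 (n + 1).factorial_ne_zero
    simp_rw [mul_pow]
    rw [intervalIntegral.integral_div, intervalIntegral.integral_mul_const,
      integral_one_sub_sq_pow, poch_one]
    field_simp
    ring
  have hsum' := hsum.mul_left (2 * x)
  simp_rw [hterm] at hsum'
  have hint : ∫ t in (0 : ℝ)..1, Complex.exp ((1 - (t : ℂ) ^ 2) * x)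
      = Complex.exp x * ∫ t in (0 : ℝ)..1, Complex.exp (-((t : ℂ) ^ 2 * x)) := by
    rw [← intervalIntegral.integral_const_mul]
    congr 1 with t
    rw [← Complex.exp_add]
    ring_nf
  rw [hint] at hsum'
  unfold hyp1F1
  rw [((hasSum_nat_add_iff (f := fun m : ℕ =>
    poch 1 m / (poch (1 / 2) m * (m.factorial : ℂ)) * x ^ m) 1).1 hsum').tsum_eq]
  simp only [Finset.sum_range_one, poch, Finset.range_zero, Finset.prod_empty, Nat.factorial_zero,
    Nat.cast_one, pow_zero]
  ring

lemma sqrt_pi_ne_zero : (Real.sqrt Real.pi : ℂ) ≠ 0 :=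
  Complex.ofReal_ne_zero.2 (Real.sqrt_ne_zero'.2 Real.pi_pos)

lemma hyp1F1_one_half_eq_cerf (w : ℂ) :
    hyp1F1 1 (1 / 2) (w ^ 2 / 4)
      = 1 + (Real.sqrt Real.pi : ℂ) * w / 2 * Complex.exp (w ^ 2 / 4) * cerf (w / 2) := by
  have hpi := sqrt_pi_ne_zero
  rw [hyp1F1_one_half, cerf, intervalIntegral.integral_const_mul]
  have : ∀ t : ℝ, (t : ℂ) ^ 2 * (w ^ 2 / 4) = (t * (w / 2)) ^ 2 := fun t => by ring
  simp_rw [this]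
  field_simp
  ring

lemma hyp1F1_one_half_eq_cerfi (w : ℂ) :
    hyp1F1 1 (1 / 2) (-w ^ 2 / 4)
      = 1 - (Real.sqrt Real.pi : ℂ) * w / 2 * Complex.exp (-w ^ 2 / 4) * cerfi (w / 2) := by
  have hpi := sqrt_pi_ne_zero
  rw [hyp1F1_one_half, cerfi, intervalIntegral.integral_const_mul]
  have : ∀ t : ℝ, -((t : ℂ) ^ 2 * (-w ^ 2 / 4)) = (t * (w / 2)) ^ 2 := fun t => by ring
  simp_rw [this]
  field_simp
  ring

lemma Gamma_neg_half : Complex.Gamma (-1 / 2) = -2 * (Real.sqrt Real.pi : ℂ) := by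
  have h := Complex.Gamma_add_one (-1 / 2) (by norm_num)
  have h' : Complex.Gamma (1 / 2) = (Real.sqrt Real.pi : ℂ) := by
    rw [← Real.Gamma_one_half_eq, ← Complex.Gamma_ofReal]
    norm_num
  rw [show (-1 / 2 + 1 : ℂ) = 1 / 2 by norm_num, h'] at h
  rw [h]
  ring

lemma riemannZeta_neg_one : riemannZeta (-1) = -1 / 12 := by
  have h := riemannZeta_neg_nat_eq_bernoulli 1
  norm_num [bernoulli_two, bernoulli_eq_bernoulli'_of_ne_one] at h
  rw [h]
  norm_num

/-- the limit as `z → 1` of the second bracket on the right-hand side of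
the generalized Ramanujan–Guinand formula. -/
theorem limit_second_bracket (w : ℂ) (a b : ℝ) (ha : 0 < a) (hb : 0 < b) :
    Filter.Tendsto
      (fun z : ℂ => (1/4) * Complex.Gamma (-z/2) * riemannZeta (-z) *
        ((b:ℂ) ^ ((1 + z)/2) * hyp1F1 ((1 + z)/2) (1/2) (w^2/4)
          - (a:ℂ) ^ ((1 + z)/2) * hyp1F1 ((1 + z)/2) (1/2) (-w^2/4)))
      (nhdsWithin 1 {(1:ℂ)}ᶜ)
      (nhds ((Real.sqrt Real.pi : ℂ) / 24 *
        ((b:ℂ) * (1 + (Real.sqrt Real.pi : ℂ) * w / 2 * Complex.exp (w^2/4) * cerf (w/2))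
          - (a:ℂ) * (1 - (Real.sqrt Real.pi : ℂ) * w / 2 * Complex.exp (-w^2/4) * cerfi (w/2))))) := by
  have harg : ContinuousAt (fun z : ℂ => (1 + z) / 2) 1 := by fun_prop
  have harg1 : ((1 + 1) / 2 : ℂ) = 1 := by norm_num
  have hF : ∀ x : ℂ, ContinuousAt (fun z : ℂ => hyp1F1 ((1 + z) / 2) (1 / 2) x) 1 := fun x =>
    ContinuousAt.comp_of_eq (continuousAt_hyp1F1_half x) harg harg1
  have hpow : ∀ c : ℝ, 0 < c → ContinuousAt (fun z : ℂ => (c : ℂ) ^ ((1 + z) / 2)) 1 :=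
    fun c hc => harg.const_cpow (Or.inl (Complex.ofReal_ne_zero.2 hc.ne'))
  have hGamma : ContinuousAt (fun z : ℂ => Complex.Gamma (-z / 2)) 1 := by
    refine ContinuousAt.comp_of_eq
      (Complex.differentiableAt_Gamma (-1 / 2) fun m hm => ?_).continuousAt
      (by fun_prop) rfl
    have h : ((2 * m : ℕ) : ℂ) = (1 : ℕ) := by push_cast; linear_combination 2 * hm
    have := Nat.cast_injective h
    omega
  have hzeta : ContinuousAt (fun z : ℂ => riemannZeta (-z)) 1 :=
    ContinuousAt.comp_of_eq (differentiableAt_riemannZeta (s := -1) (by norm_num)).continuousAt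
      (by fun_prop) rfl
  have hmain := ((continuousAt_const (y := (1 / 4 : ℂ))).mul hGamma |>.mul hzeta).mul
    (((hpow b hb).mul (hF (w ^ 2 / 4))).sub ((hpow a ha).mul (hF (-w ^ 2 / 4))))
  convert! hmain.tendsto.mono_left nhdsWithin_le_nhds using 1
  refine congrArg nhds ?_
  simp only [Pi.mul_apply, Pi.sub_apply, harg1, Complex.cpow_one, hyp1F1_one_half_eq_cerf,
    hyp1F1_one_half_eq_cerfi, Gamma_neg_half, riemannZeta_neg_one]
  ring

end
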